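/- arXiv:2506.00231 — 3 statements merged into one kernel-verified Lean document; each statement's English description precedes it below -/
import Mathlib

section
/- Let A₀ be a densely defined skew-symmetric operator on a complex Hilbert space H, let A := (-A₀)*, let (H₊, H₋, G₊, G₋) be a boundary quadruple for A₀, and let B be an operator on H extending A₀. Then B is m-dissipative if and only if there exists a linear contraction Φ : H₋ → H₊ such that B = A_Φ, where A_Φ is the restriction of A to D(A_Φ) := {ψ ∈ D(A) : G₊ψ = Φ G₋ψ}. -/
open scoped ComplexInnerProductSpace

lemma aux_skew {H : Type*} [NormedAddCommGroup H] [InnerProductSpace ℂ H]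
    (D D0 : Submodule ℂ H) (T : H →ₗ[ℂ] H) (hle : D0 ≤ D)
    (hD : ∀ ψ ∈ D, (⟪T ψ, ψ⟫).re ≤ 0) (hD0 : ∀ ψ ∈ D0, (⟪T ψ, ψ⟫).re = 0)
    (ψ : H) (hψ : ψ ∈ D) (φ : H) (hφ : φ ∈ D0) : ⟪T ψ, φ⟫ + ⟪ψ, T φ⟫ = 0 := by
  set z : ℂ := ⟪T ψ, φ⟫ + ⟪ψ, T φ⟫ with hz
  have key : ∀ t : ℂ, (⟪T ψ, ψ⟫).re + (t * z).re ≤ 0 := by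
    intro t
    have h1 := hD (ψ + t • φ) (D.add_mem hψ (D.smul_mem t (hle hφ)))
    have h2 := hD0 (t • φ) (D0.smul_mem t hφ)
    have h3 : (⟪T (t • φ), ψ⟫).re = (t * ⟪ψ, T φ⟫).re := by
      rw [← inner_conj_symm, Complex.conj_re, map_smul, inner_smul_right]
    have h4 : (⟪T ψ, t • φ⟫).re = (t * ⟪T ψ, φ⟫).re := by rw [inner_smul_right]
    rw [map_add, inner_add_left, inner_add_right, inner_add_right] at h1
    simp only [Complex.add_re] at h1
    rw [hz, mul_add, Complex.add_re]
    linarith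
  by_contra hne
  have hpos : 0 < Complex.normSq z := Complex.normSq_pos.2 hne
  have := key (((-(⟪T ψ, ψ⟫).re + 1) / Complex.normSq z : ℝ) * (starRingEnd ℂ) z)
  rw [mul_assoc, mul_comm ((starRingEnd ℂ) z), Complex.mul_conj, ← Complex.ofReal_mul,
    Complex.ofReal_re, div_mul_cancel₀ _ hpos.ne'] at this
  linarith

lemma aux_lower {H : Type*} [NormedAddCommGroup H] [InnerProductSpace ℂ H]
    (x y : H) (h : (⟪y, x⟫).re ≤ 0) : ‖x‖ ≤ ‖y - x‖ := by
  have h1 : ‖y - x‖ ^ 2 = ‖y‖ ^ 2 - 2 * (⟪y, x⟫).re + ‖x‖ ^ 2 := by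
    simpa using @norm_sub_sq ℂ H _ _ _ y x
  nlinarith [norm_nonneg x, norm_nonneg (y - x), sq_nonneg ‖y‖]

lemma aux_extend {E Hp Hm : Type*} [AddCommGroup E] [Module ℂ E]
    [NormedAddCommGroup Hp] [InnerProductSpace ℂ Hp] [CompleteSpace Hp]
    [NormedAddCommGroup Hm] [InnerProductSpace ℂ Hm] [CompleteSpace Hm]
    (f : E →ₗ[ℂ] Hp) (g : E →ₗ[ℂ] Hm) (h : ∀ x, ‖f x‖ ≤ ‖g x‖) :
    ∃ Φ : Hm →L[ℂ] Hp, (∀ ξ, ‖Φ ξ‖ ≤ ‖ξ‖) ∧ ∀ x, Φ (g x) = f x := by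
  let K := (LinearMap.range g).topologicalClosure
  have hK : IsClosed (K : Set Hm) := Submodule.isClosed_topologicalClosure _
  haveI : CompleteSpace K := hK.completeSpace_coe
  have hmem : ∀ x, g x ∈ K := fun x =>
    Submodule.le_topologicalClosure _ (LinearMap.mem_range_self g x)
  let e : E →ₗ[ℂ] K := g.codRestrict K hmem
  have hd : DenseRange e := by
    intro k
    rw [closure_subtype]
    have : (Subtype.val '' Set.range e) = (LinearMap.range g : Set Hm) := by
      ext y
      simp [e]
    rw [this]
    exact k.2
  have hn : ∀ x, ‖f x‖ ≤ 1 * ‖e x‖ := fun x => by rw [one_mul]; exact h x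
  refine ⟨(f.extendOfNorm e).comp K.orthogonalProjectionOnto, fun ξ => ?_, fun x => ?_⟩
  · refine (LinearMap.norm_extendOfNorm_apply_le hd 1 hn _).trans ?_
    rw [one_mul]
    exact K.norm_orthogonalProjectionOnto_apply_le ξ
  · have : K.orthogonalProjectionOnto (g x) = e x :=
      K.orthogonalProjectionOnto_mem_subspace_eq_self (e x)
    rw [ContinuousLinearMap.comp_apply, this]
    exact LinearMap.extendOfNorm_eq hd ⟨1, hn⟩ x

/-- Let `A₀` be a densely defined skew-symmetric operator on a complex
Hilbert space `H`, let `A := (-A₀)*` (characterized by `hAdom`, `hAval`), let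
`(Hp, Hm, Gp, Gm)` be a boundary quadruple for `A₀`, and let `B` be an operator on `H`
extending `A₀`. Then `B` is m-dissipative (dissipative, densely defined, and `B − 1`
bijective from `D(B)` onto `H`) if and only if there is a linear contraction
`Φ : Hm → Hp` with `B = A_Φ`, i.e. `D(B) = {ψ ∈ D(A) : G₊ψ = Φ G₋ψ}` and `B = A`
on `D(B)`. -/
theorem stmt_2
    {H Hp Hm : Type*}
    [NormedAddCommGroup H] [InnerProductSpace ℂ H] [CompleteSpace H]
    [NormedAddCommGroup Hp] [InnerProductSpace ℂ Hp] [CompleteSpace Hp]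
    [NormedAddCommGroup Hm] [InnerProductSpace ℂ Hm] [CompleteSpace Hm]
    (A₀dom : Submodule ℂ H) (A₀ : H →ₗ[ℂ] H)
    (hdense : Dense (A₀dom : Set H))
    (hskew₁ : ∀ ψ ∈ A₀dom, (⟪A₀ ψ, ψ⟫).re ≤ 0)
    (hskew₂ : ∀ ψ ∈ A₀dom, (⟪-(A₀ ψ), ψ⟫).re ≤ 0)
    (Adom : Submodule ℂ H) (A : H →ₗ[ℂ] H)
    (hAdom : ∀ x : H, x ∈ Adom ↔ ∃ η : H, ∀ φ ∈ A₀dom, ⟪x, -(A₀ φ)⟫ = ⟪η, φ⟫)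
    (hAval : ∀ x ∈ Adom, ∀ φ ∈ A₀dom, ⟪x, -(A₀ φ)⟫ = ⟪A x, φ⟫)
    (Gp : H →ₗ[ℂ] Hp) (Gm : H →ₗ[ℂ] Hm)
    (hGreen : ∀ ψ ∈ Adom, ∀ φ ∈ Adom,
      ⟪A ψ, φ⟫ + ⟪ψ, A φ⟫ = ⟪Gp ψ, Gp φ⟫ - ⟪Gm ψ, Gm φ⟫)
    (hSurj : ∀ (ξ : Hp) (ζ : Hm), ∃ ψ ∈ Adom, Gp ψ = ξ ∧ Gm ψ = ζ)
    (Bdom : Submodule ℂ H) (B : H →ₗ[ℂ] H)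
    (hBextdom : A₀dom ≤ Bdom)
    (hBextval : ∀ ψ ∈ A₀dom, B ψ = A₀ ψ) :
    ((∀ ψ ∈ Bdom, (⟪B ψ, ψ⟫).re ≤ 0) ∧ Dense (Bdom : Set H) ∧
        Function.Bijective (fun ψ : Bdom => B (ψ : H) - (ψ : H))) ↔
      ∃ Φ : Hm →L[ℂ] Hp, (∀ ξ : Hm, ‖Φ ξ‖ ≤ ‖ξ‖) ∧
        (∀ x : H, x ∈ Bdom ↔ (x ∈ Adom ∧ Gp x = Φ (Gm x))) ∧
        (∀ x ∈ Bdom, B x = A x) := by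
  have hz : ∀ ψ ∈ A₀dom, (⟪A₀ ψ, ψ⟫).re = 0 := by
    intro ψ h
    have h1 := hskew₁ ψ h
    have h2 := hskew₂ ψ h
    rw [inner_neg_left, Complex.neg_re] at h2
    linarith
  -- `A` is determined by its defining property
  have hAchar : ∀ x η : H, (∀ φ ∈ A₀dom, ⟪x, -(A₀ φ)⟫ = ⟪η, φ⟫) → x ∈ Adom ∧ A x = η := by
    intro x η h
    have hx : x ∈ Adom := (hAdom x).2 ⟨η, h⟩
    refine ⟨hx, hdense.eq_of_inner_left ℂ fun v hv => ?_⟩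
    rw [← hAval x hx v hv, h v hv]
  -- dissipative extensions of `A₀` are restrictions of `A`
  have hsub : (∀ ψ ∈ Bdom, (⟪B ψ, ψ⟫).re ≤ 0) → ∀ x ∈ Bdom, x ∈ Adom ∧ A x = B x := by
    intro hB x hx
    refine hAchar x (B x) fun φ hφ => ?_
    have := aux_skew Bdom A₀dom B hBextdom hB
      (fun ψ h => by rw [hBextval ψ h]; exact hz ψ h) x hx φ hφ
    rw [hBextval φ hφ] at this
    rw [inner_neg_right]
    linear_combination -this
  have hA₀ : ∀ x ∈ A₀dom, x ∈ Adom ∧ A x = A₀ x := by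
    intro x hx
    refine hAchar x (A₀ x) fun φ hφ => ?_
    have := aux_skew A₀dom A₀dom A₀ le_rfl hskew₁ hz x hx φ hφ
    rw [inner_neg_right]
    linear_combination -this
  -- energy identity
  have hen : ∀ ψ ∈ Adom, 2 * (⟪A ψ, ψ⟫).re = ‖Gp ψ‖ ^ 2 - ‖Gm ψ‖ ^ 2 := by
    intro ψ hψ
    have h := congrArg Complex.re (hGreen ψ hψ ψ hψ)
    have h2 : (⟪ψ, A ψ⟫).re = (⟪A ψ, ψ⟫).re := by rw [← inner_conj_symm, Complex.conj_re]
    have h3 : (⟪Gp ψ, Gp ψ⟫).re = ‖Gp ψ‖ ^ 2 := inner_self_eq_norm_sq (𝕜 := ℂ) (Gp ψ)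
    have h4 : (⟪Gm ψ, Gm ψ⟫).re = ‖Gm ψ‖ ^ 2 := inner_self_eq_norm_sq (𝕜 := ℂ) (Gm ψ)
    rw [Complex.add_re, Complex.sub_re, h2, h3, h4] at h
    linarith
  have hdiss : ∀ Φ : Hm →L[ℂ] Hp, (∀ ξ : Hm, ‖Φ ξ‖ ≤ ‖ξ‖) →
      ∀ x ∈ Adom, Gp x = Φ (Gm x) → (⟪A x, x⟫).re ≤ 0 := by
    intro Φ hΦ x hx hG
    have h1 := hen x hx
    have h2 := hΦ (Gm x)
    rw [hG] at h1
    nlinarith [norm_nonneg (Φ (Gm x)), norm_nonneg (Gm x)]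
  constructor
  · rintro ⟨hB, -, -, hsurj⟩
    have hsB := hsub hB
    obtain ⟨Φ, hΦ, hΦG⟩ := aux_extend (Gp.comp Bdom.subtype) (Gm.comp Bdom.subtype) (by
      rintro ⟨x, hx⟩
      obtain ⟨hxA, hAx⟩ := hsB x hx
      have h1 := hen x hxA
      have h2 := hB x hx
      rw [hAx] at h1
      exact (sq_le_sq₀ (norm_nonneg _) (norm_nonneg _)).1 (by
        change ‖Gp x‖ ^ 2 ≤ ‖Gm x‖ ^ 2
        linarith))
    have hfw : ∀ x ∈ Bdom, x ∈ Adom ∧ Gp x = Φ (Gm x) :=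
      fun x hx => ⟨(hsB x hx).1, (hΦG ⟨x, hx⟩).symm⟩
    refine ⟨Φ, hΦ, fun x => ⟨hfw x, ?_⟩, fun x hx => (hsB x hx).2.symm⟩
    rintro ⟨hxA, hxG⟩
    obtain ⟨⟨y, hy⟩, hyx⟩ := hsurj (A x - x)
    change B y - y = A x - x at hyx
    rw [← (hsB y hy).2] at hyx
    obtain ⟨hyA, hyG⟩ := hfw y hy
    have h0 := hdiss Φ hΦ (x - y) (Adom.sub_mem hxA hyA) (by
      rw [map_sub, map_sub, map_sub, hxG, hyG])
    have h1 := aux_lower _ _ h0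
    have h2 : A (x - y) - (x - y) = 0 := by
      rw [map_sub, sub_sub_sub_comm, hyx, sub_self]
    rw [h2, norm_zero] at h1
    have h3 : x - y = 0 := norm_le_zero_iff.1 h1
    rw [sub_eq_zero.1 h3]
    exact hy
  · rintro ⟨Φ, hΦ, hBd, hBA⟩
    have hB : ∀ ψ ∈ Bdom, (⟪B ψ, ψ⟫).re ≤ 0 := by
      intro ψ hψ
      obtain ⟨h1, h2⟩ := (hBd ψ).1 hψ
      rw [hBA ψ hψ]
      exact hdiss Φ hΦ ψ h1 h2
    refine ⟨hB, hdense.mono hBextdom, ?_, ?_⟩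
    · rintro ⟨x, hx⟩ ⟨y, hy⟩ hxy
      change B x - x = B y - y at hxy
      have h1 := aux_lower _ _ (hB (x - y) (Bdom.sub_mem hx hy))
      rw [map_sub, sub_sub_sub_comm, hxy, sub_self, norm_zero] at h1
      exact Subtype.ext (sub_eq_zero.1 (norm_le_zero_iff.1 h1))
    · let T : Bdom →ₗ[ℂ] H := B.comp Bdom.subtype - Bdom.subtype
      have hT : ∀ x : Bdom, T x = B x - x := fun x => rfl
      let R := LinearMap.range T
      have hadj : ∀ (u : Hp) (v : Hm), ⟪ContinuousLinearMap.adjoint Φ u, v⟫ = ⟪u, Φ v⟫ :=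
        fun u v => ContinuousLinearMap.adjoint_inner_left Φ v u
      have hRcl : IsClosed (R : Set H) := by
        refine IsSeqClosed.isClosed fun u g hu hug => ?_
        choose p hp using hu
        have hpc : CauchySeq (fun n => (p n : H)) := by
          have hc := hug.cauchySeq
          rw [Metric.cauchySeq_iff] at hc ⊢
          intro ε hε
          obtain ⟨N, hN⟩ := hc ε hε
          refine ⟨N, fun m hm n hn => lt_of_le_of_lt ?_ (hN m hm n hn)⟩
          rw [dist_eq_norm, dist_eq_norm, ← hp m, ← hp n, ← map_sub]
          exact aux_lower _ _ (hB _ (p m - p n).2)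
        obtain ⟨x, hx⟩ := cauchySeq_tendsto_of_complete hpc
        have hAp : Filter.Tendsto (fun n => A (p n)) Filter.atTop (nhds (g + x)) := by
          refine (hug.add hx).congr fun n => ?_
          rw [← hp n, hT, hBA _ (p n).2]
          abel
        obtain ⟨hxA, hAx⟩ := hAchar x (g + x) (by
          intro φ hφ
          have h1 : Filter.Tendsto (fun n => ⟪(p n : H), -(A₀ φ)⟫) Filter.atTop
            (nhds ⟪x, -(A₀ φ)⟫) := hx.inner tendsto_const_nhds
          have h2 : Filter.Tendsto (fun n => ⟪A (p n), φ⟫) Filter.atTop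
            (nhds ⟪g + x, φ⟫) := hAp.inner tendsto_const_nhds
          refine tendsto_nhds_unique h1 (h2.congr fun n => ?_)
          exact (hAval _ ((hBd _).1 (p n).2).1 φ hφ).symm)
        have hxG : Gp x = Φ (Gm x) := by
          obtain ⟨φ, hφ, hφp, hφm⟩ := hSurj (Gp x - Φ (Gm x))
            (ContinuousLinearMap.adjoint Φ (Gp x - Φ (Gm x)))
          have hval : ∀ y ∈ Adom, ⟪A φ, y⟫ + ⟪φ, A y⟫ =
              ⟪Gp x - Φ (Gm x), Gp y - Φ (Gm y)⟫ := by
            intro y hy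
            rw [hGreen φ hφ y hy, hφp, hφm, hadj, inner_sub_right _ (Gp y)]
          have h1 : Filter.Tendsto (fun n => ⟪A φ, (p n : H)⟫ + ⟪φ, A (p n)⟫) Filter.atTop
              (nhds (⟪A φ, x⟫ + ⟪φ, g + x⟫)) :=
            (tendsto_const_nhds.inner hx).add (tendsto_const_nhds.inner hAp)
          have h2 : ⟪A φ, x⟫ + ⟪φ, g + x⟫ = 0 := by
            refine tendsto_nhds_unique h1 (tendsto_const_nhds.congr fun n => ?_)
            obtain ⟨ha, hb⟩ := (hBd _).1 (p n).2
            rw [hval _ ha, hb, sub_self, inner_zero_right]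
          rw [← hAx, hval x hxA] at h2
          exact sub_eq_zero.1 (inner_self_eq_zero.1 h2)
        have hxB : x ∈ Bdom := (hBd x).2 ⟨hxA, hxG⟩
        refine ⟨⟨x, hxB⟩, ?_⟩
        rw [hT]
        change B x - x = g
        rw [hBA x hxB, hAx]
        abel
      have hRo : Rᗮ = ⊥ := by
        rw [Submodule.eq_bot_iff]
        intro f hf
        have hf' : ∀ y ∈ Bdom, ⟪f, A y⟫ = ⟪f, y⟫ := by
          intro y hy
          have := (Submodule.mem_orthogonal' _ _).1 hf (T ⟨y, hy⟩) (LinearMap.mem_range_self _ _)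
          rw [hT] at this
          change ⟪f, B y - y⟫ = 0 at this
          rw [hBA y hy, inner_sub_right] at this
          exact sub_eq_zero.1 this
        obtain ⟨hfA, hAf⟩ := hAchar f (-f) (by
          intro φ hφ
          rw [inner_neg_right, inner_neg_left, ← (hA₀ φ hφ).2, hf' φ (hBextdom hφ)])
        have hG : Gm f = ContinuousLinearMap.adjoint Φ (Gp f) := by
          refine ext_inner_right ℂ fun v => ?_
          obtain ⟨y, hy, hyp, hym⟩ := hSurj (Φ v) v
          have hyB : y ∈ Bdom := (hBd y).2 ⟨hy, by rw [hyp, hym]⟩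
          have h1 := hGreen f hfA y hy
          rw [hAf, hf' y hyB, inner_neg_left, neg_add_cancel, hyp, hym] at h1
          rw [hadj]
          exact (sub_eq_zero.1 h1.symm).symm
        have hle : ‖Gm f‖ ≤ ‖Gp f‖ := by
          have hn : ‖Φ‖ ≤ 1 := Φ.opNorm_le_bound zero_le_one (by simpa using hΦ)
          rw [hG]
          refine (ContinuousLinearMap.le_opNorm _ _).trans ?_
          rw [LinearIsometryEquiv.norm_map]
          exact mul_le_of_le_one_left (norm_nonneg _) hn
        have h1 := hen f hfA
        have h2 : (⟪f, f⟫).re = ‖f‖ ^ 2 := inner_self_eq_norm_sq (𝕜 := ℂ) f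
        rw [hAf, inner_neg_left, Complex.neg_re, h2] at h1
        have h3 : ‖f‖ ^ 2 ≤ 0 := by nlinarith [norm_nonneg (Gm f), norm_nonneg (Gp f)]
        exact norm_eq_zero.1 (pow_eq_zero_iff two_ne_zero |>.1 (le_antisymm h3 (sq_nonneg _)))
      haveI : CompleteSpace R := hRcl.completeSpace_coe
      have hRt : R = ⊤ := Submodule.orthogonal_eq_bot_iff.1 hRo
      intro g
      have hg : g ∈ R := by rw [hRt]; trivial
      obtain ⟨y, hy⟩ := hg
      exact ⟨y, hy⟩
end

section
/- Let A₀ be a densely defined skew-symmetric operator on a complex Hilbert space H, let A := (-A₀)*, let (H₊, H₋, G₊, G₋) be a boundary quadruple for A₀, and let Φ : H₋ → H₊ be a strictly contractive linear map, i.e. ‖Φξ‖_{H₊} < ‖ξ‖_{H₋} for all ξ ≠ 0. Let A_Φ be the restriction of A to D(A_Φ) := {ψ ∈ D(A) : G₊ψ = Φ G₋ψ}, and suppose there exists α ∈ ℂ such that A_Φ − α : D(A_Φ) → H is bijective with compact (bounded) inverse. Let (W_t)_{t≥0} be a C₀ contraction semigroup on H whose generator equals A_Φ. Then the following are equivalent: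 (1) the closure of A₀ has no eigenvalue on the imaginary axis, i.e. there is no λ ∈ ℝ and ψ ≠ 0 in D(closure(A₀)) with closure(A₀)ψ = iλψ; (2) ‖W_t ψ₀‖_H → 0 as t → ∞ for every ψ₀ ∈ H. -/
open scoped ComplexInnerProductSpace
open Filter Topology

theorem aux_eigen {K : Type*} [NormedAddCommGroup K] [InnerProductSpace ℂ K] [CompleteSpace K]
    (T : K →L[ℂ] K) (hT : IsCompactOperator T) (hT0 : T ≠ 0) (a : ℝ)
    (h : ∀ y w : K, ⟪y, T w⟫ + ⟪T y, w⟫ + ((2 * a : ℝ) : ℂ) * ⟪T y, T w⟫ = 0) :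
    ∃ (μ : ℂ) (y : K), μ ≠ 0 ∧ y ≠ 0 ∧ T y = μ • y := by
  by_contra hcon
  push Not at hcon
  have hno : ∀ μ : ℂ, μ ≠ 0 → μ ∈ resolventSet ℂ T := by
    intro μ hμ
    rcases hT.hasEigenvalue_or_mem_resolventSet hμ with h1 | h1
    · obtain ⟨y, hy⟩ := h1.exists_hasEigenvector
      exact absurd hy.apply_eq_smul (hcon μ y hμ hy.2)
    · exact h1
  have hadj : T + star T + ((2 * a : ℝ) : ℂ) • (star T * T) = 0 := by
    ext w
    refine ext_inner_left ℂ fun y => ?_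
    have := h y w
    simp only [ContinuousLinearMap.star_eq_adjoint, add_apply,
      smul_apply, mul_apply_eq_comp, inner_add_right,
      inner_smul_right, ContinuousLinearMap.adjoint_inner_right, zero_apply,
      inner_zero_right]
    exact this
  have hnormal : star T * T = T * star T := by
    by_cases ha : a = 0
    · subst ha
      have h2 : star T = -T := by
        simp only [mul_zero, Complex.ofReal_zero, zero_smul, add_zero] at hadj
        exact (neg_eq_of_add_eq_zero_right hadj).symm
      rw [h2]; simp
    · set c : ℂ := ((2 * a : ℝ) : ℂ) with hc
      have hc0 : c ≠ 0 := by
        rw [hc]; simpa using ha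
      have hU1 : (1 + c • star T) * (1 + c • T) = 1 := by
        have : (1 + c • star T) * (1 + c • T) = 1 + c • (T + star T + c • (star T * T)) := by
          simp only [add_mul, mul_add, one_mul, mul_one, smul_mul_assoc, mul_smul_comm, smul_add]
          abel
        rw [this, hadj]; simp
      have hu : IsUnit (1 + c • T) := by
        have h3 := hno (-c⁻¹) (by simpa using hc0)
        rw [spectrum.mem_resolventSet_iff] at h3
        have h4 : 1 + c • T = (-c) • (algebraMap ℂ (K →L[ℂ] K) (-c⁻¹) - T) := by
          rw [Algebra.algebraMap_eq_smul_one, smul_sub, smul_smul]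
          simp [hc0]
        rw [h4]
        exact (h3.smul (Units.mk0 (-c) (by simpa using hc0)))
      have hU2 : (1 + c • T) * (1 + c • star T) = 1 := by
        obtain ⟨u, hu⟩ := hu
        rw [← hu] at hU1 ⊢
        rw [Units.eq_inv_of_mul_eq_one_right hU1]; simp
      have h5 := hU1.trans hU2.symm
      simp only [add_mul, mul_add, one_mul, mul_one, smul_mul_assoc, mul_smul_comm, smul_add] at h5
      have h6 : c • c • (star T * T) = c • c • (T * star T) := by
        have := sub_eq_zero.2 h5
        rw [← sub_eq_zero, ← this]; abel
      exact smul_right_injective _ hc0 (smul_right_injective _ hc0 h6)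
  have hN : IsStarNormal T := ⟨hnormal⟩
  have : Nontrivial (K →L[ℂ] K) := ⟨T, 0, hT0⟩
  obtain ⟨z, hz, hz2⟩ := spectrum.exists_nnnorm_eq_spectralRadius T
  rw [hN.spectralRadius_eq_nnnorm] at hz2
  have hz0 : z ≠ 0 := by
    rintro rfl
    simp at hz2
    exact hT0 (nnnorm_eq_zero.1 hz2.symm)
  exact hz (hno z hz0)

theorem aux_mem_closure {H : Type*} [NormedAddCommGroup H] [InnerProductSpace ℂ H]
    [CompleteSpace H]
    (A₀dom : Submodule ℂ H) (A₀ : H →ₗ[ℂ] H) (x y : H)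
    (h : ∀ u v : H, (∀ φ ∈ A₀dom, ⟪v, -(A₀ φ)⟫ = ⟪u, φ⟫) → ⟪u, x⟫ + ⟪v, y⟫ = 0) :
    (x, y) ∈ closure {p : H × H | p.1 ∈ A₀dom ∧ p.2 = A₀ p.1} := by
  let e := WithLp.prodContinuousLinearEquiv 2 ℂ H H
  let f : H →ₗ[ℂ] WithLp 2 (H × H) :=
    e.symm.toLinearEquiv.toLinearMap ∘ₗ (LinearMap.id.prod A₀)
  let K : Submodule ℂ (WithLp 2 (H × H)) := A₀dom.map f
  have h1 : WithLp.toLp 2 (x, y) ∈ K.topologicalClosure := by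
    rw [← Submodule.orthogonal_orthogonal_eq_closure]
    intro z hz
    rw [WithLp.prod_inner_apply]
    refine h _ _ fun φ hφ => ?_
    have h2 : ⟪f φ, z⟫ = 0 := hz _ ⟨φ, hφ, rfl⟩
    rw [inner_eq_zero_symm, WithLp.prod_inner_apply] at h2
    have h3 : ⟪z.fst, φ⟫ + ⟪z.snd, A₀ φ⟫ = 0 := h2
    rw [inner_neg_right]
    exact (neg_eq_of_add_eq_zero_left h3)
  have h4 : e (WithLp.toLp 2 (x, y)) ∈ closure (e '' (K : Set _)) :=
    image_closure_subset_closure_image e.continuous ⟨_, h1, rfl⟩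
  refine closure_mono ?_ h4
  rintro _ ⟨_, ⟨φ, hφ, rfl⟩, rfl⟩
  exact ⟨hφ, rfl⟩

theorem aux_skew_s4 {H : Type*} [NormedAddCommGroup H] [InnerProductSpace ℂ H]
    (A₀dom : Submodule ℂ H) (A₀ : H →ₗ[ℂ] H)
    (hskew₁ : ∀ ψ ∈ A₀dom, (⟪A₀ ψ, ψ⟫).re ≤ 0)
    (hskew₂ : ∀ ψ ∈ A₀dom, (⟪-(A₀ ψ), ψ⟫).re ≤ 0) :
    ∀ ψ ∈ A₀dom, ∀ φ ∈ A₀dom, ⟪A₀ ψ, φ⟫ + ⟪ψ, A₀ φ⟫ = 0 := by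
  have h0 : ∀ ψ ∈ A₀dom, ⟪A₀ ψ, ψ⟫ + ⟪ψ, A₀ ψ⟫ = 0 := by
    intro ψ hψ
    have h1 := hskew₁ ψ hψ
    have h2 := hskew₂ ψ hψ
    rw [inner_neg_left, Complex.neg_re] at h2
    rw [← inner_conj_symm ψ (A₀ ψ), Complex.add_conj]
    rw [show (⟪A₀ ψ, ψ⟫).re = 0 by linarith]; simp
  intro ψ hψ φ hφ
  have h1 := h0 _ (A₀dom.add_mem hψ hφ)
  have h2 := h0 _ (A₀dom.add_mem hψ (A₀dom.smul_mem Complex.I hφ))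
  have h3 := h0 _ hψ
  have h4 := h0 _ hφ
  simp only [map_add, map_smul, inner_add_left, inner_add_right, inner_smul_left,
    inner_smul_right, Complex.conj_I] at h1 h2
  have h5 : Complex.I * (⟪A₀ ψ, φ⟫ + ⟪ψ, A₀ φ⟫ - ⟪A₀ φ, ψ⟫ - ⟪φ, A₀ ψ⟫) = 0 := by
    linear_combination h2 - h3 + Complex.I * Complex.I * h4
  have h6 := (mul_eq_zero.1 h5).resolve_left Complex.I_ne_zero
  linear_combination (h1 - h3 - h4 + h6) / 2

theorem aux_recur {H : Type*} [NormedAddCommGroup H] [InnerProductSpace ℂ H]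
    (R : H →L[ℂ] H) (hRcompact : IsCompactOperator R) (hRd : DenseRange R)
    (W : ℝ → H →L[ℂ] H)
    (hWsemi : ∀ s t : ℝ, 0 ≤ s → 0 ≤ t → W (s + t) = (W s).comp (W t))
    (hWcontr : ∀ t : ℝ, 0 ≤ t → ∀ x : H, ‖W t x‖ ≤ ‖x‖)
    (hcomm : ∀ t : ℝ, 0 ≤ t → ∀ y : H, W t (R y) = R (W t y))
    (y : H) (hy : ∀ s : ℝ, 0 ≤ s → ‖W s y‖ = ‖y‖) (T : ℝ) (hT : 0 ≤ T) (ε : ℝ) (hε : 0 < ε) :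
    ∃ t : ℝ, T ≤ t ∧ ‖W t y - y‖ < ε := by
  obtain ⟨x, hx⟩ := hRd.exists_dist_lt y (show 0 < ε / 3 by positivity)
  rw [dist_eq_norm] at hx
  obtain ⟨K, hK, hK'⟩ := hRcompact.image_closedBall_subset_compact ‖x‖
  have hnT : ∀ n : ℕ, 0 ≤ (n : ℝ) * T := fun n => by positivity
  obtain ⟨z, -, φ, hφ, hlim⟩ := hK.tendsto_subseq (x := fun n : ℕ => R (W (n * T) x))
    (fun n => hK' ⟨W (n * T) x, by simpa using hWcontr _ (hnT n) x, rfl⟩)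
  have hc := hlim.cauchySeq
  rw [Metric.cauchySeq_iff'] at hc
  obtain ⟨N, hN⟩ := hc (ε / 3) (by positivity)
  have h1 := hN (N + 1) (Nat.le_succ N)
  simp only [Function.comp_apply, dist_eq_norm] at h1
  rw [← hcomm _ (hnT _), ← hcomm _ (hnT _)] at h1
  have hlt : φ N < φ (N + 1) := hφ (Nat.lt_succ_self N)
  set m := φ (N + 1)
  set n := φ N
  have hmn : (n : ℝ) + 1 ≤ m := by exact_mod_cast hlt
  have hTle : T ≤ m * T - n * T := by nlinarith
  refine ⟨m * T - n * T, hTle, ?_⟩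
  have h2 : ‖W (m * T) y - W (n * T) y‖ < ε := by
    have e : W (m * T) y - W (n * T) y = W (m * T) (y - R x) +
      (W (m * T) (R x) - W (n * T) (R x)) - W (n * T) (y - R x) := by
      simp only [map_sub]; abel
    rw [e]
    have := norm_sub_le (W (m * T) (y - R x) +
      (W (m * T) (R x) - W (n * T) (R x))) (W (n * T) (y - R x))
    have := norm_add_le (W (m * T) (y - R x)) (W (m * T) (R x) - W (n * T) (R x))
    have := hWcontr _ (hnT m) (y - R x)
    have := hWcontr _ (hnT n) (y - R x)
    linarith
  have hd : 0 ≤ m * T - n * T := hT.trans hTle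
  -- `W` acts isometrically on differences
  have h3 : W (m * T) y = W (n * T) (W (m * T - n * T) y) := by
    have := hWsemi (n * T) (m * T - n * T) (hnT n) hd
    rw [add_sub_cancel] at this
    rw [this]; rfl
  have hre : ∀ s : ℝ, 0 ≤ s → ∀ u v : H, ‖W s u‖ = ‖u‖ → ‖W s v‖ = ‖v‖ →
      ‖W s (u - v)‖ = ‖u - v‖ := by
    intro s hs u v hu hv
    have p1 := parallelogram_law_with_norm ℂ u v
    have p2 := parallelogram_law_with_norm ℂ (W s u) (W s v)
    rw [← map_add, ← map_sub, hu, hv] at p2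
    have c1 := hWcontr s hs (u + v)
    have c2 := hWcontr s hs (u - v)
    nlinarith [norm_nonneg (W s (u + v)), norm_nonneg (W s (u - v)), norm_nonneg (u + v),
      norm_nonneg (u - v)]
  rw [h3, ← map_sub, hre _ (hnT n)] at h2
  · exact h2
  · rw [← h3, hy _ (hnT m), hy _ hd]
  · exact hy _ (hnT n)

theorem aux_anti {H : Type*} [NormedAddCommGroup H] [InnerProductSpace ℂ H]
    (W : ℝ → H →L[ℂ] H)
    (hWsemi : ∀ s t : ℝ, 0 ≤ s → 0 ≤ t → W (s + t) = (W s).comp (W t))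
    (hWcontr : ∀ t : ℝ, 0 ≤ t → ∀ x : H, ‖W t x‖ ≤ ‖x‖)
    (x : H) (s t : ℝ) (hs : 0 ≤ s) (hst : s ≤ t) : ‖W t x‖ ≤ ‖W s x‖ := by
  have := hWsemi (t - s) s (by linarith) hs
  rw [sub_add_cancel] at this
  rw [this]
  exact hWcontr _ (by linarith) _

theorem aux_inv {H : Type*} [NormedAddCommGroup H] [InnerProductSpace ℂ H]
    (R : H →L[ℂ] H) (hRcompact : IsCompactOperator R) (hRd : DenseRange R)
    (W : ℝ → H →L[ℂ] H)
    (hWsemi : ∀ s t : ℝ, 0 ≤ s → 0 ≤ t → W (s + t) = (W s).comp (W t))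
    (hWcontr : ∀ t : ℝ, 0 ≤ t → ∀ x : H, ‖W t x‖ ≤ ‖x‖)
    (hcomm : ∀ t : ℝ, 0 ≤ t → ∀ y : H, W t (R y) = R (W t y))
    (y : H) (hy : ∀ s : ℝ, 0 ≤ s → ‖W s y‖ = ‖y‖) (s : ℝ) (hs : 0 ≤ s) :
    ‖W s (R y)‖ = ‖R y‖ := by
  refine le_antisymm (hWcontr s hs _) (le_of_forall_pos_le_add fun ε hε => ?_)
  obtain ⟨t, hst, ht⟩ := aux_recur R hRcompact hRd W hWsemi hWcontr hcomm y hy s hs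
    (ε / (‖R‖ + 1)) (by positivity)
  have h1 : ‖R (W t y - y)‖ ≤ ε := by
    refine (R.le_opNorm _).trans ?_
    calc ‖R‖ * ‖W t y - y‖ ≤ (‖R‖ + 1) * (ε / (‖R‖ + 1)) := by gcongr; linarith
      _ = ε := by field_simp
  have h2 := aux_anti W hWsemi hWcontr (R y) s t hs hst
  have h3 := norm_sub_norm_le (R y) (W t (R y))
  rw [map_sub, ← hcomm t (hs.trans hst), norm_sub_rev] at h1
  linarith

theorem aux_decay {H : Type*} [NormedAddCommGroup H] [InnerProductSpace ℂ H]
    (R : H →L[ℂ] H) (hRcompact : IsCompactOperator R) (hRd : DenseRange R)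
    (W : ℝ → H →L[ℂ] H)
    (hWsemi : ∀ s t : ℝ, 0 ≤ s → 0 ≤ t → W (s + t) = (W s).comp (W t))
    (hWcontr : ∀ t : ℝ, 0 ≤ t → ∀ x : H, ‖W t x‖ ≤ ‖x‖)
    (hcomm : ∀ t : ℝ, 0 ≤ t → ∀ y : H, W t (R y) = R (W t y))
    (hE : ∀ y : H, (∀ s : ℝ, 0 ≤ s → ‖W s y‖ = ‖y‖) → y = 0) (x : H) :
    Tendsto (fun t : ℝ => ‖W t x‖) atTop (𝓝 0) := by
  -- it suffices to find small values
  have key : ∀ x : H, (∀ ε > 0, ∃ T : ℝ, 0 ≤ T ∧ ‖W T x‖ < ε) →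
      Tendsto (fun t : ℝ => ‖W t x‖) atTop (𝓝 0) := by
    intro x h
    rw [Metric.tendsto_atTop]
    intro ε hε
    obtain ⟨T, hT, hT'⟩ := h ε hε
    refine ⟨T, fun t ht => ?_⟩
    simp only [dist_zero_right, norm_norm]
    exact (aux_anti W hWsemi hWcontr x T t hT ht).trans_lt hT'
  apply key
  intro ε hε
  obtain ⟨z, hz⟩ := hRd.exists_dist_lt x (show 0 < ε / 2 by positivity)
  rw [dist_eq_norm] at hz
  suffices h : ∃ T : ℝ, 0 ≤ T ∧ ‖W T (R z)‖ < ε / 2 by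
    obtain ⟨T, hT, h⟩ := h
    refine ⟨T, hT, ?_⟩
    have h1 := hWcontr T hT (x - R z)
    have h2 := norm_add_le (W T (x - R z)) (W T (R z))
    rw [← map_add, sub_add_cancel] at h2
    linarith
  obtain ⟨K, hK, hK'⟩ := hRcompact.image_closedBall_subset_compact ‖z‖
  obtain ⟨y, -, φ, hφ, hlim⟩ := hK.tendsto_subseq (x := fun n : ℕ => R (W n z))
    (fun n => hK' ⟨W n z, by simpa using hWcontr _ (Nat.cast_nonneg n) z, rfl⟩)
  have hlim' : Tendsto (fun n => W (φ n) (R z)) atTop (𝓝 y) := by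
    refine hlim.congr fun n => ?_
    simp [hcomm _ (Nat.cast_nonneg (φ n))]
  have hy0 : y = 0 := by
    apply hE
    intro s hs
    refine le_antisymm (hWcontr s hs y) ?_
    have hl1 : Tendsto (fun n => ‖W s (W (φ n) (R z))‖) atTop (𝓝 ‖W s y‖) :=
      (((W s).continuous.tendsto y).comp hlim').norm
    refine ge_of_tendsto hl1 (Eventually.of_forall fun n => ?_)
    have hmono : ∀ t : ℝ, 0 ≤ t → ‖y‖ ≤ ‖W t (R z)‖ := by
      intro t ht
      refine le_of_tendsto hlim'.norm ?_
      have : Tendsto (fun n => ((φ n : ℕ) : ℝ)) atTop atTop :=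
        tendsto_natCast_atTop_atTop.comp hφ.tendsto_atTop
      filter_upwards [this.eventually_ge_atTop t] with n hn
      exact aux_anti W hWsemi hWcontr (R z) t _ ht hn
    have h5 := hWsemi s (φ n) hs (Nat.cast_nonneg _)
    have h6 := hmono (s + φ n) (by positivity)
    rw [h5] at h6
    exact h6
  rw [hy0] at hlim'
  have h7 := hlim'.norm
  rw [norm_zero] at h7
  obtain ⟨n, hn⟩ := (h7.eventually_lt_const (show 0 < ε / 2 by positivity)).exists
  exact ⟨φ n, Nat.cast_nonneg _, hn⟩

theorem aux_closure {H Hp Hm : Type*}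
    [NormedAddCommGroup H] [InnerProductSpace ℂ H] [CompleteSpace H]
    [NormedAddCommGroup Hp] [InnerProductSpace ℂ Hp]
    [NormedAddCommGroup Hm] [InnerProductSpace ℂ Hm]
    (A₀dom : Submodule ℂ H) (A₀ : H →ₗ[ℂ] H)
    (hdense : Dense (A₀dom : Set H))
    (hsk : ∀ ψ ∈ A₀dom, ∀ φ ∈ A₀dom, ⟪A₀ ψ, φ⟫ + ⟪ψ, A₀ φ⟫ = 0)
    (Adom : Submodule ℂ H) (A : H →ₗ[ℂ] H)
    (hAdom : ∀ x : H, x ∈ Adom ↔ ∃ η : H, ∀ φ ∈ A₀dom, ⟪x, -(A₀ φ)⟫ = ⟪η, φ⟫)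
    (hAval : ∀ x ∈ Adom, ∀ φ ∈ A₀dom, ⟪x, -(A₀ φ)⟫ = ⟪A x, φ⟫)
    (Gp : H →ₗ[ℂ] Hp) (Gm : H →ₗ[ℂ] Hm)
    (hGreen : ∀ ψ ∈ Adom, ∀ φ ∈ Adom,
      ⟪A ψ, φ⟫ + ⟪ψ, A φ⟫ = ⟪Gp ψ, Gp φ⟫ - ⟪Gm ψ, Gm φ⟫)
    (hSurj : ∀ (ξ : Hp) (ζ : Hm), ∃ ψ ∈ Adom, Gp ψ = ξ ∧ Gm ψ = ζ)
    (x y : H) (hxy : (x, y) ∈ closure {p : H × H | p.1 ∈ A₀dom ∧ p.2 = A₀ p.1}) :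
    x ∈ Adom ∧ A x = y ∧ Gp x = 0 ∧ Gm x = 0 := by
  have h1 : ∀ φ ∈ A₀dom, ⟪x, -(A₀ φ)⟫ = ⟪y, φ⟫ := by
    intro φ hφ
    have hcl : IsClosed {p : H × H | ⟪p.1, -(A₀ φ)⟫ = ⟪p.2, φ⟫} :=
      isClosed_eq (by fun_prop) (by fun_prop)
    refine closure_minimal ?_ hcl hxy
    rintro ⟨p, q⟩ ⟨hp, hq⟩
    simp only at hp hq
    subst hq
    have := hsk p hp φ hφ
    simp only [Set.mem_ofPred_eq, inner_neg_right]
    exact neg_eq_of_add_eq_zero_left this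
  have hx : x ∈ Adom := (hAdom x).2 ⟨y, h1⟩
  have hAx : A x = y := by
    refine hdense.eq_of_inner_left (𝕜 := ℂ) fun v hv => ?_
    rw [← hAval x hx v hv, h1 v hv]
  have h2 : ∀ φ ∈ Adom, ⟪y, φ⟫ + ⟪x, A φ⟫ = 0 := by
    intro φ hφ
    have hcl : IsClosed {p : H × H | ⟪p.2, φ⟫ + ⟪p.1, A φ⟫ = 0} :=
      isClosed_eq (by fun_prop) (by fun_prop)
    refine closure_minimal ?_ hcl hxy
    rintro ⟨p, q⟩ ⟨hp, hq⟩
    simp only at hp hq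
    subst hq
    have h3 := hAval φ hφ p hp
    rw [inner_neg_right] at h3
    simp only [Set.mem_ofPred_eq]
    rw [← inner_conj_symm, ← inner_conj_symm p, ← h3]
    simp
  obtain ⟨ψ, hψ, e1, e2⟩ := hSurj (Gp x) (-Gm x)
  have h3 := hGreen x hx ψ hψ
  rw [hAx, h2 ψ hψ, e1, e2, inner_neg_right, sub_neg_eq_add, inner_self_eq_norm_sq_to_K,
    inner_self_eq_norm_sq_to_K] at h3
  have h4 : (0 : ℝ) = ‖Gp x‖ ^ 2 + ‖Gm x‖ ^ 2 := by
    simpa [← Complex.ofReal_pow] using congrArg Complex.re h3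
  refine ⟨hx, hAx, ?_, ?_⟩
  · rw [← norm_eq_zero]; nlinarith [sq_nonneg ‖Gp x‖, sq_nonneg ‖Gm x‖]
  · rw [← norm_eq_zero]; nlinarith [sq_nonneg ‖Gp x‖, sq_nonneg ‖Gm x‖]

/-- An eigenvector of the generator with imaginary eigenvalue keeps its norm. -/
theorem aux_const {H : Type*} [NormedAddCommGroup H] [InnerProductSpace ℂ H]
    (W : ℝ → H →L[ℂ] H) (hW0 : W 0 = 1)
    (hWsemi : ∀ s t : ℝ, 0 ≤ s → 0 ≤ t → W (s + t) = (W s).comp (W t))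
    (hWcont : ∀ x : H, ContinuousOn (fun t : ℝ => W t x) (Set.Ici 0))
    (x : H) (l : ℝ)
    (hx : Tendsto (fun t : ℝ => t⁻¹ • (W t x - x)) (𝓝[>] 0) (𝓝 ((Complex.I * (l : ℂ)) • x)))
    (t : ℝ) (ht : 0 ≤ t) : ‖W t x‖ = ‖x‖ := by
  have hd : ∀ s ∈ Set.Ico 0 t, HasDerivWithinAt (fun s : ℝ => W s x)
      ((Complex.I * (l : ℂ)) • W s x) (Set.Ici s) s := by
    intro s hs
    rw [hasDerivWithinAt_iff_tendsto_slope, Set.Ici_sdiff_left]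
    have h1 := ((W s).continuous.tendsto _).comp hx
    rw [map_smul] at h1
    have h2 : Tendsto (fun r : ℝ => r - s) (𝓝[>] s) (𝓝[>] 0) := by
      refine tendsto_nhdsWithin_iff.2 ⟨?_, ?_⟩
      · have : Tendsto (fun r : ℝ => r - s) (𝓝 s) (𝓝 (s - s)) := by
          exact (continuous_id.sub continuous_const).tendsto s
        rw [sub_self] at this
        exact this.mono_left nhdsWithin_le_nhds
      · filter_upwards [self_mem_nhdsWithin] with r hr
        simpa using hr
    refine (h1.comp h2).congr' ?_
    filter_upwards [self_mem_nhdsWithin] with r hr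
    have hr' : s < r := hr
    have := hWsemi s (r - s) hs.1 (by linarith)
    rw [add_sub_cancel] at this
    simp [slope_def_module, this]
  have he : ∀ s : ℝ, HasDerivAt (fun s : ℝ => Complex.exp (-(Complex.I * (l : ℂ)) * (s : ℂ)))
      (Complex.exp (-(Complex.I * (l : ℂ)) * (s : ℂ)) * -(Complex.I * (l : ℂ))) s := by
    intro s
    have h1 : HasDerivAt (fun s : ℝ => -(Complex.I * (l : ℂ)) * (s : ℂ))
        (-(Complex.I * (l : ℂ))) s := by
      simpa using (Complex.ofRealCLM.hasDerivAt (x := s)).const_mul (-(Complex.I * (l : ℂ)))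
    exact h1.cexp
  have hconst := constant_of_has_deriv_right_zero
    (f := fun s : ℝ => Complex.exp (-(Complex.I * (l : ℂ)) * (s : ℂ)) • W s x) (a := 0) (b := t)
    (by
      refine ContinuousOn.smul ?_ ((hWcont x).mono fun s hs => hs.1)
      fun_prop)
    (by
      intro s hs
      have := (he s).hasDerivWithinAt.smul (hd s hs)
      exact this.congr_deriv (by module)) t ⟨ht, le_rfl⟩
  have hn := congrArg norm hconst
  simp only [norm_smul, Complex.norm_exp] at hn
  simpa [hW0] using hn

/-- The closed subspace of vectors on which the semigroup is isometric. -/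
def isoSpace {H : Type*} [NormedAddCommGroup H] [InnerProductSpace ℂ H]
    (W : ℝ → H →L[ℂ] H) (hWcontr : ∀ t : ℝ, 0 ≤ t → ∀ x : H, ‖W t x‖ ≤ ‖x‖) :
    Submodule ℂ H where
  carrier := {y | ∀ s : ℝ, 0 ≤ s → ‖W s y‖ = ‖y‖}
  zero_mem' := by intro s _; simp
  smul_mem' := by
    intro c x hx s hs
    rw [map_smul, norm_smul, norm_smul, hx s hs]
  add_mem' := by
    intro u v hu' hv' s hs
    have hu := hu' s hs
    have hv := hv' s hs
    have p1 := parallelogram_law_with_norm ℂ u v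
    have p2 := parallelogram_law_with_norm ℂ (W s u) (W s v)
    rw [← map_add, ← map_sub, hu, hv] at p2
    have c1 := hWcontr s hs (u + v)
    have c2 := hWcontr s hs (u - v)
    nlinarith [norm_nonneg (W s (u + v)), norm_nonneg (W s (u - v)), norm_nonneg (u + v),
      norm_nonneg (u - v)]

theorem isoSpace_closed {H : Type*} [NormedAddCommGroup H] [InnerProductSpace ℂ H]
    (W : ℝ → H →L[ℂ] H) (hWcontr : ∀ t : ℝ, 0 ≤ t → ∀ x : H, ‖W t x‖ ≤ ‖x‖) :
    IsClosed (isoSpace W hWcontr : Set H) := by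
  have : (isoSpace W hWcontr : Set H) = ⋂ s : ℝ, ⋂ _ : 0 ≤ s, {y | ‖W s y‖ = ‖y‖} := by
    ext y
    simp only [Set.mem_iInter]
    rfl
  rw [this]
  refine isClosed_iInter fun s => isClosed_iInter fun _ => isClosed_eq ?_ ?_ <;> fun_prop

theorem aux_energy {H : Type*} [NormedAddCommGroup H] [InnerProductSpace ℂ H]
    (W : ℝ → H →L[ℂ] H) (hW0 : W 0 = 1)
    (hWcont : ∀ x : H, ContinuousOn (fun t : ℝ => W t x) (Set.Ici 0))
    (x z : H) (hx : Tendsto (fun t : ℝ => t⁻¹ • (W t x - x)) (𝓝[>] 0) (𝓝 z))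
    (hE : ∀ s : ℝ, 0 ≤ s → ‖W s x‖ = ‖x‖) : (⟪z, x⟫).re = 0 := by
  have h1 : Tendsto (fun t : ℝ => W t x) (𝓝[>] 0) (𝓝 x) := by
    have := (hWcont x 0 (by simp)).mono (Set.Ioi_subset_Ici_self)
    simpa [ContinuousWithinAt, hW0] using this
  have h2 : Tendsto (fun t : ℝ => (⟪t⁻¹ • (W t x - x), W t x + x⟫).re) (𝓝[>] 0)
      (𝓝 (⟪z, x + x⟫).re) :=
    (Complex.continuous_re.tendsto _).comp (hx.inner (h1.add_const x))
  have h3 : Tendsto (fun t : ℝ => (⟪t⁻¹ • (W t x - x), W t x + x⟫).re) (𝓝[>] 0) (𝓝 0) := by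
    refine tendsto_const_nhds.congr' ?_
    filter_upwards [self_mem_nhdsWithin] with t ht
    have ht' : (0 : ℝ) ≤ t := le_of_lt ht
    have e1 : (⟪W t x - x, W t x + x⟫).re = 0 := by
      have a1 := inner_self_eq_norm_sq (𝕜 := ℂ) (W t x)
      have a2 := inner_self_eq_norm_sq (𝕜 := ℂ) x
      have a3 := inner_re_symm (𝕜 := ℂ) (W t x) x
      simp only [inner_sub_left, inner_add_right, Complex.sub_re, Complex.add_re]
      simp only [RCLike.re_to_complex] at a1 a2 a3
      rw [a1, a2, a3, hE t ht']
      ring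
    rw [← Complex.coe_smul, inner_smul_left]
    simp [e1]
  have h4 := tendsto_nhds_unique h2 h3
  rw [inner_add_right, Complex.add_re] at h4
  linarith

/-- Let `A₀` be a densely defined skew-symmetric operator on a complex
Hilbert space `H`, `A := (-A₀)*`, `(Hp, Hm, Gp, Gm)` a boundary quadruple for `A₀`, and
`Φ : Hm → Hp` a strictly contractive linear map. Let `A_Φ` be the restriction of `A` to
`{ψ ∈ D(A) : G₊ψ = Φ G₋ψ}` and suppose `A_Φ − α` is bijective from its domain onto `H`
with compact inverse `R`. Let `(W t)` be a C₀ contraction semigroup whose generator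
equals `A_Φ` (`hgen` characterizing the domain via existence of the limit, `hgenval`
identifying the limit with `A`). Then: the closure of `A₀` has no eigenvalue on the
imaginary axis iff `‖W t ψ₀‖ → 0` as `t → ∞` for all `ψ₀ ∈ H`. -/
theorem stmt_4
    {H Hp Hm : Type*}
    [NormedAddCommGroup H] [InnerProductSpace ℂ H] [CompleteSpace H]
    [NormedAddCommGroup Hp] [InnerProductSpace ℂ Hp] [CompleteSpace Hp]
    [NormedAddCommGroup Hm] [InnerProductSpace ℂ Hm] [CompleteSpace Hm]
    (A₀dom : Submodule ℂ H) (A₀ : H →ₗ[ℂ] H)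
    (hdense : Dense (A₀dom : Set H))
    (hskew₁ : ∀ ψ ∈ A₀dom, (⟪A₀ ψ, ψ⟫).re ≤ 0)
    (hskew₂ : ∀ ψ ∈ A₀dom, (⟪-(A₀ ψ), ψ⟫).re ≤ 0)
    (Adom : Submodule ℂ H) (A : H →ₗ[ℂ] H)
    (hAdom : ∀ x : H, x ∈ Adom ↔ ∃ η : H, ∀ φ ∈ A₀dom, ⟪x, -(A₀ φ)⟫ = ⟪η, φ⟫)
    (hAval : ∀ x ∈ Adom, ∀ φ ∈ A₀dom, ⟪x, -(A₀ φ)⟫ = ⟪A x, φ⟫)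
    (Gp : H →ₗ[ℂ] Hp) (Gm : H →ₗ[ℂ] Hm)
    (hGreen : ∀ ψ ∈ Adom, ∀ φ ∈ Adom,
      ⟪A ψ, φ⟫ + ⟪ψ, A φ⟫ = ⟪Gp ψ, Gp φ⟫ - ⟪Gm ψ, Gm φ⟫)
    (hSurj : ∀ (ξ : Hp) (ζ : Hm), ∃ ψ ∈ Adom, Gp ψ = ξ ∧ Gm ψ = ζ)
    (Φ : Hm →L[ℂ] Hp) (hΦ : ∀ ξ : Hm, ξ ≠ 0 → ‖Φ ξ‖ < ‖ξ‖)
    (α : ℂ) (R : H →L[ℂ] H) (hRcompact : IsCompactOperator R)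
    (hR₁ : ∀ x ∈ Adom, Gp x = Φ (Gm x) → R (A x - α • x) = x)
    (hR₂ : ∀ y : H, R y ∈ Adom ∧ Gp (R y) = Φ (Gm (R y)) ∧ A (R y) - α • R y = y)
    (W : ℝ → H →L[ℂ] H)
    (hW0 : W 0 = 1)
    (hWsemi : ∀ s t : ℝ, 0 ≤ s → 0 ≤ t → W (s + t) = (W s).comp (W t))
    (hWcont : ∀ x : H, ContinuousOn (fun t : ℝ => W t x) (Set.Ici 0))
    (hWcontr : ∀ t : ℝ, 0 ≤ t → ∀ x : H, ‖W t x‖ ≤ ‖x‖)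
    (hgen : ∀ x : H, (x ∈ Adom ∧ Gp x = Φ (Gm x)) ↔
      ∃ η : H, Tendsto (fun t : ℝ => t⁻¹ • (W t x - x)) (𝓝[>] 0) (𝓝 η))
    (hgenval : ∀ x ∈ Adom, Gp x = Φ (Gm x) →
      Tendsto (fun t : ℝ => t⁻¹ • (W t x - x)) (𝓝[>] 0) (𝓝 (A x))) :
    (∀ (l : ℝ) (x y : H),
        (x, y) ∈ closure {p : H × H | p.1 ∈ A₀dom ∧ p.2 = A₀ p.1} →
        y = (Complex.I * (l : ℂ)) • x → x = 0) ↔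
      (∀ ψ₀ : H, Tendsto (fun t : ℝ => ‖W t ψ₀‖) atTop (𝓝 0)) := by
  have hsk := aux_skew_s4 A₀dom A₀ hskew₁ hskew₂
  have hcl := aux_closure A₀dom A₀ hdense hsk Adom A hAdom hAval Gp Gm hGreen hSurj
  -- the range of `R` is dense
  have hRd : DenseRange R := by
    refine hdense.mono fun φ hφ => ?_
    obtain ⟨h1, -, h3, h4⟩ := hcl φ (A₀ φ) (subset_closure ⟨hφ, rfl⟩)
    exact ⟨_, hR₁ φ h1 (by rw [h3, h4, map_zero])⟩
  -- `R` commutes with the semigroup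
  have hcomm : ∀ t : ℝ, 0 ≤ t → ∀ y : H, W t (R y) = R (W t y) := by
    intro t ht y
    obtain ⟨h1, h2, h3⟩ := hR₂ y
    have h4 : Tendsto (fun s : ℝ => s⁻¹ • (W s (W t (R y)) - W t (R y))) (𝓝[>] 0)
        (𝓝 (W t (A (R y)))) := by
      refine (((W t).continuous.tendsto _).comp (hgenval _ h1 h2)).congr' ?_
      filter_upwards [self_mem_nhdsWithin] with s hs
      have hs' : (0 : ℝ) ≤ s := le_of_lt hs
      have e1 : W s (W t (R y)) = W t (W s (R y)) := by
        have a1 := hWsemi s t hs' ht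
        rw [add_comm, hWsemi t s ht hs'] at a1
        exact (DFunLike.congr_fun a1 (R y)).symm
      simp [e1]
    obtain ⟨h5, h6⟩ := (hgen _).2 ⟨_, h4⟩
    have h7 : A (W t (R y)) = W t (A (R y)) := tendsto_nhds_unique (hgenval _ h5 h6) h4
    have h8 := hR₁ _ h5 h6
    rw [h7, ← map_smul, ← map_sub, h3] at h8
    exact h8.symm
  constructor
  · intro hno
    by_contra hdec
    have hE : ¬ ∀ y : H, (∀ s : ℝ, 0 ≤ s → ‖W s y‖ = ‖y‖) → y = 0 := fun h =>
      hdec (aux_decay R hRcompact hRd W hWsemi hWcontr hcomm h)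
    push Not at hE
    obtain ⟨y₀, hy₀, hy₀0⟩ := hE
    let E := isoSpace W hWcontr
    have hEcl : IsClosed (E : Set H) := isoSpace_closed W hWcontr
    have : CompleteSpace E := hEcl.completeSpace_coe
    have hRE : ∀ y ∈ E, R y ∈ E := fun y hy s hs =>
      aux_inv R hRcompact hRd W hWsemi hWcontr hcomm y hy s hs
    let T : E →L[ℂ] E := (R.comp E.subtypeL).codRestrict E (fun y => hRE y y.2)
    have hTc : IsCompactOperator T :=
      (hRcompact.comp_clm E.subtypeL).codRestrict (fun y => hRE y y.2) hEcl
    have hRinj : ∀ y, R y = 0 → y = 0 := by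
      intro y hy
      have := (hR₂ y).2.2
      rw [hy] at this
      simpa using this.symm
    have hT0 : T ≠ 0 := by
      intro h
      have h1 : T ⟨y₀, hy₀⟩ = 0 := by rw [h]; rfl
      exact hy₀0 (hRinj y₀ (congrArg Subtype.val h1))
    -- boundary values vanish on the isometric part
    have hG : ∀ y ∈ E, Gp (R y) = 0 ∧ Gm (R y) = 0 ∧ (⟪A (R y), R y⟫).re = 0 := by
      intro y hy
      obtain ⟨h1, h2, h3⟩ := hR₂ y
      have h4 := aux_energy W hW0 hWcont (R y) (A (R y)) (hgenval _ h1 h2) (hRE y hy)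
      have h5 := congrArg Complex.re (hGreen _ h1 _ h1)
      have a1 := inner_self_eq_norm_sq (𝕜 := ℂ) (Gp (R y))
      have a2 := inner_self_eq_norm_sq (𝕜 := ℂ) (Gm (R y))
      have a3 := inner_re_symm (𝕜 := ℂ) (R y) (A (R y))
      simp only [RCLike.re_to_complex] at a1 a2 a3
      rw [Complex.add_re, Complex.sub_re, a1, a2, a3, h4, h2] at h5
      have h6 : Gm (R y) = 0 := by
        by_contra hne
        have := hΦ _ hne
        nlinarith [norm_nonneg (Φ (Gm (R y)))]
      exact ⟨by rw [h2, h6, map_zero], h6, h4⟩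
    obtain ⟨μ, ⟨y, hy⟩, hμ, hy0, hyμ⟩ := aux_eigen T hTc hT0 α.re (by
      rintro ⟨y, hy⟩ ⟨w, hw⟩
      show ⟪y, R w⟫ + ⟪R y, w⟫ + ((2 * α.re : ℝ) : ℂ) * ⟪R y, R w⟫ = 0
      have h1 := hGreen _ (hR₂ y).1 _ (hR₂ w).1
      rw [(hG y hy).1, (hG y hy).2.1, inner_zero_left, inner_zero_left, sub_zero,
        sub_eq_iff_eq_add.1 (hR₂ y).2.2, sub_eq_iff_eq_add.1 (hR₂ w).2.2,
        inner_add_left, inner_add_right, inner_smul_left, inner_smul_right] at h1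
      have h2 := Complex.add_conj α
      rw [← h2]
      linear_combination h1)
    have hyμ' : R y = μ • y := congrArg Subtype.val hyμ
    have hyne : R y ≠ 0 := fun h => hy0 (Subtype.ext (hRinj y h))
    set x := R y with hx
    obtain ⟨g1, g2, g3⟩ := hG y hy
    obtain ⟨r1, r2, r3⟩ := hR₂ y
    rw [← hx] at g1 g2 g3 r1 r2 r3
    have hAx : A x = (α + μ⁻¹) • x := by
      rw [add_smul, sub_eq_iff_eq_add.1 r3, add_comm]
      congr 1
      rw [hyμ', smul_smul, inv_mul_cancel₀ hμ, one_smul]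
    have hre : (α + μ⁻¹).re = 0 := by
      rw [hAx, inner_smul_left, inner_self_eq_norm_sq_to_K] at g3
      have : (α + μ⁻¹).re * ‖x‖ ^ 2 = 0 := by
        simpa [← Complex.ofReal_pow] using g3
      exact (mul_eq_zero.1 this).resolve_right (by simpa using hyne)
    refine hyne (hno (α + μ⁻¹).im x (A x) ?_ ?_)
    · apply aux_mem_closure
      intro u v huv
      have hv : v ∈ Adom := (hAdom v).2 ⟨u, huv⟩
      have hAv : A v = u := by
        refine hdense.eq_of_inner_left (𝕜 := ℂ) fun w hw => ?_
        rw [← hAval v hv w hw, huv w hw]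
      have := hGreen v hv x r1
      rw [g1, g2, hAv] at this
      simpa using this
    · rw [hAx]
      congr 1
      apply Complex.ext
      · rw [hre]; simp
      · simp
  · intro hdec l x y hxy hyx
    obtain ⟨h1, h2, h3, h4⟩ := hcl x y hxy
    have h5 := hgenval x h1 (by rw [h3, h4, map_zero])
    rw [h2, hyx] at h5
    have h6 := aux_const W hW0 hWsemi hWcont x l h5
    have h7 : Tendsto (fun t : ℝ => ‖W t x‖) atTop (𝓝 ‖x‖) := by
      refine tendsto_const_nhds.congr' ?_
      filter_upwards [eventually_ge_atTop (0 : ℝ)] with t ht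
      exact (h6 t ht).symm
    exact norm_eq_zero.1 (tendsto_nhds_unique h7 (hdec x))
end

section
/- Let B be a densely defined linear operator on a complex Hilbert space H, and suppose there exists λ ∈ ℂ such that B − λ : D(B) → H is bijective and its inverse (B − λ)⁻¹ : H → H is a compact bounded linear operator. Then the set S := {μ ∈ ℂ : B − μ : D(B) → H is not bijective} is countable, and every μ ∈ S is an eigenvalue of B, i.e. there exists ψ ∈ D(B), ψ ≠ 0, with Bψ = μψ. -/
open scoped ComplexInnerProductSpace

open InnerProductSpace in
lemma finite_large_eigenvalues {H : Type*} [NormedAddCommGroup H] [InnerProductSpace ℂ H]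
    (R : H →L[ℂ] H) (hR : IsCompactOperator R) (ε : ℝ) (hε : 0 < ε) :
    {ν : ℂ | Module.End.HasEigenvalue (R : Module.End ℂ H) ν ∧ ε ≤ ‖ν‖}.Finite := by
  by_contra hinf
  have hinf : {ν : ℂ | Module.End.HasEigenvalue (R : Module.End ℂ H) ν ∧ ε ≤ ‖ν‖}.Infinite := hinf
  let e := hinf.natEmbedding
  let ν : ℕ → ℂ := fun n => (e n : ℂ)
  have hν_inj : Function.Injective ν := Subtype.val_injective.comp e.injective
  have hν : ∀ n, ∃ v, Module.End.HasEigenvector (R : Module.End ℂ H) (ν n) v :=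
    fun n => (e n).2.1.exists_hasEigenvector
  have hνε : ∀ n, ε ≤ ‖ν n‖ := fun n => (e n).2.2
  choose v hv using hν
  have hli : LinearIndependent ℂ v :=
    Module.End.eigenvectors_linearIndependent' _ ν hν_inj v hv
  have hRv : ∀ n, R (v n) = ν n • v n := fun n => (hv n).apply_eq_smul
  let V : ℕ → Submodule ℂ H := fun n => Submodule.span ℂ (v '' Set.Iio n)
  have hRV : ∀ n, ∀ w ∈ V n, R w ∈ V n := by
    intro n w hw
    have : V n ≤ (V n).comap (R : H →ₗ[ℂ] H) := by
      refine Submodule.span_le.2 ?_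
      rintro _ ⟨i, hi, rfl⟩
      change R (v i) ∈ V n
      rw [hRv]
      exact (V n).smul_mem _ (Submodule.subset_span ⟨i, hi, rfl⟩)
    exact this hw
  let g : ℕ → H := gramSchmidtNormed ℂ v
  have hgn : ∀ n, ‖g n‖ = 1 := fun n => gramSchmidtNormed_unit_length n hli
  have hgV : ∀ n, ∀ w ∈ V n, inner ℂ (g n) w = 0 := by
    intro n w hw
    refine Submodule.span_induction ?_ ?_ ?_ ?_ hw
    · rintro _ ⟨i, hi, rfl⟩
      simp only [g, gramSchmidtNormed, inner_smul_left]
      rw [gramSchmidt_inv_triangular ℂ v hi, mul_zero]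
    · simp
    · intro x y _ _ hx hy
      rw [inner_add_right, hx, hy, add_zero]
    · intro a x _ hx
      rw [inner_smul_right, hx, mul_zero]
  have hgs : ∀ m n, m < n → gramSchmidt ℂ v m ∈ V n := by
    intro m n h
    change _ ∈ Submodule.span ℂ (v '' Set.Iio n)
    rw [← span_gramSchmidt_Iio]
    exact Submodule.subset_span ⟨m, h, rfl⟩
  have hgm : ∀ m n, m < n → g m ∈ V n := fun m n h => (V n).smul_mem _ (hgs m n h)
  have hdiff : ∀ n, R (g n) - ν n • g n ∈ V n := by
    intro n
    obtain ⟨w, hw, hgw⟩ : ∃ w ∈ V n, gramSchmidt ℂ v n = v n - w := by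
      refine ⟨_, ?_, gramSchmidt_def ℂ v n⟩
      refine Submodule.sum_mem _ fun i hi => ?_
      rw [Submodule.starProjection_singleton]
      exact (V n).smul_mem _ (hgs i n (Finset.mem_Iio.1 hi))
    have h1 : R (gramSchmidt ℂ v n) - ν n • gramSchmidt ℂ v n = ν n • w - R w := by
      rw [hgw, map_sub, hRv]
      module
    have h2 : R (g n) - ν n • g n =
        ((‖gramSchmidt ℂ v n‖ : ℂ)⁻¹) • (R (gramSchmidt ℂ v n) - ν n • gramSchmidt ℂ v n) := by
      change R (((‖gramSchmidt ℂ v n‖ : ℂ)⁻¹) • gramSchmidt ℂ v n) -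
        ν n • (((‖gramSchmidt ℂ v n‖ : ℂ)⁻¹) • gramSchmidt ℂ v n) = _
      rw [map_smul]
      module
    rw [h2, h1]
    exact (V n).smul_mem _ ((V n).sub_mem ((V n).smul_mem _ hw) (hRV n w hw))
  have hsep : ∀ m n, m < n → ε ≤ ‖R (g n) - R (g m)‖ := by
    intro m n h
    have h1 := hgV n _ ((V n).sub_mem (hdiff n) (hRV n _ (hgm m n h)))
    have h2 : inner ℂ (g n) (R (g n) - R (g m)) = ν n := by
      have : R (g n) - R (g m) = (R (g n) - ν n • g n - R (g m)) + ν n • g n := by module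
      rw [this, inner_add_right, h1, inner_smul_right, inner_self_eq_norm_sq_to_K, hgn]
      simp
    calc ε ≤ ‖ν n‖ := hνε n
      _ = ‖inner ℂ (g n) (R (g n) - R (g m))‖ := by rw [h2]
      _ ≤ ‖g n‖ * ‖R (g n) - R (g m)‖ := norm_inner_le_norm _ _
      _ = _ := by rw [hgn, one_mul]
  obtain ⟨K, hK, hK'⟩ := IsCompactOperator.image_closedBall_subset_compact (𝕜₁ := ℂ)
    (f := (R : H →ₗ[ℂ] H)) hR 1
  obtain ⟨y, hyK, ψ, hψ, hψy⟩ := hK.tendsto_subseq (x := fun n => R (g n))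
    (fun n ↦ hK' ⟨g n, by simp [hgn], rfl⟩)
  replace hψy := hψy.cauchySeq
  rw [Metric.cauchySeq_iff'] at hψy
  obtain ⟨N, hN⟩ := hψy ε hε
  have h3 := hN (N + 1) (Nat.le_succ N)
  rw [dist_eq_norm] at h3
  exact absurd (hsep _ _ (hψ (Nat.lt_succ_self N))) (not_le.2 h3)

lemma countable_nonzero_eigenvalues {H : Type*} [NormedAddCommGroup H] [InnerProductSpace ℂ H]
    (R : H →L[ℂ] H) (hR : IsCompactOperator R) :
    {ν : ℂ | Module.End.HasEigenvalue (R : Module.End ℂ H) ν ∧ ν ≠ 0}.Countable := by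
  refine (Set.countable_iUnion fun n : ℕ =>
    (finite_large_eigenvalues R hR (1 / ((n : ℝ) + 1)) (by positivity)).countable).mono ?_
  rintro ν ⟨h, h0⟩
  obtain ⟨n, hn⟩ := exists_nat_one_div_lt (norm_pos_iff.2 h0)
  exact Set.mem_iUnion.2 ⟨n, h, hn.le⟩

/-- Let `B` be a densely defined linear operator on a complex Hilbert
space `H` (domain `Bdom`, values given by the linear map `B`), and suppose for some
`lam ∈ ℂ` the operator `B − lam : D(B) → H` is bijective with compact bounded inverse
`R` (encoded by `R` being a two-sided inverse). Then the set
`S = {μ : B − μ : D(B) → H is not bijective}` is countable and every `μ ∈ S` is an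
eigenvalue of `B`. -/
theorem stmt_5
    {H : Type*} [NormedAddCommGroup H] [InnerProductSpace ℂ H] [CompleteSpace H]
    (Bdom : Submodule ℂ H) (B : H →ₗ[ℂ] H)
    (hdense : Dense (Bdom : Set H))
    (lam : ℂ) (R : H →L[ℂ] H) (hRcompact : IsCompactOperator R)
    (hR₁ : ∀ x ∈ Bdom, R (B x - lam • x) = x)
    (hR₂ : ∀ y : H, R y ∈ Bdom ∧ B (R y) - lam • R y = y) :
    Set.Countable
        {μ : ℂ | ¬ Function.Bijective (fun ψ : Bdom => B (ψ : H) - μ • (ψ : H))} ∧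
      ∀ μ ∈ {μ : ℂ | ¬ Function.Bijective (fun ψ : Bdom => B (ψ : H) - μ • (ψ : H))},
        ∃ x ∈ Bdom, x ≠ 0 ∧ B x = μ • x := by
  have key : ∀ μ : ℂ, ¬ Function.Bijective (fun ψ : Bdom => B (ψ : H) - μ • (ψ : H)) →
      μ - lam ≠ 0 ∧ Module.End.HasEigenvalue (R : Module.End ℂ H) (μ - lam)⁻¹ := by
    intro μ hμ
    have hne : μ - lam ≠ 0 := by
      intro h0
      obtain rfl : μ = lam := sub_eq_zero.1 h0
      refine hμ ⟨?_, fun y => ⟨⟨R y, (hR₂ y).1⟩, (hR₂ y).2⟩⟩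
      intro a b hab
      have h := congrArg R hab
      simp only [hR₁ _ a.2, hR₁ _ b.2] at h
      exact Subtype.ext h
    refine ⟨hne, ?_⟩
    by_contra hev
    have hres := (hRcompact.hasEigenvalue_or_mem_resolventSet (inv_ne_zero hne)).resolve_left hev
    rw [spectrum.mem_resolventSet_iff, ContinuousLinearMap.isUnit_iff_bijective] at hres
    have happ : ∀ x, (algebraMap ℂ (H →L[ℂ] H) (μ - lam)⁻¹ - R) x = (μ - lam)⁻¹ • x - R x := by
      intro x
      simp [Algebra.algebraMap_eq_smul_one]
    refine hμ ⟨?_, ?_⟩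
    · intro a b hab
      have hab' : B (a : H) - μ • (a : H) = B (b : H) - μ • (b : H) := hab
      have hd : B ((a : H) - b) - lam • ((a : H) - b) = (μ - lam) • ((a : H) - b) := by
        rw [map_sub]
        linear_combination (norm := module) hab'
      have h1 := hR₁ _ (Bdom.sub_mem a.2 b.2)
      rw [hd, map_smul] at h1
      have h2 : (μ - lam)⁻¹ • ((a : H) - b) - R ((a : H) - b) = 0 := by
        nth_rewrite 1 [← h1]
        rw [inv_smul_smul₀ hne, sub_self]
      have h3 : (a : H) - b = 0 := hres.1 (by rw [happ, h2, map_zero])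
      exact Subtype.ext (sub_eq_zero.1 h3)
    · intro z
      obtain ⟨y, hy⟩ := hres.2 ((μ - lam)⁻¹ • z)
      rw [happ] at hy
      refine ⟨⟨R y, (hR₂ y).1⟩, ?_⟩
      change B (R y) - μ • R y = z
      have h1 := congrArg (fun t => (μ - lam) • t) hy
      simp only [smul_sub, smul_inv_smul₀ hne] at h1
      linear_combination (norm := module) h1 + (hR₂ y).2
  refine ⟨?_, ?_⟩
  · refine ((countable_nonzero_eigenvalues R hRcompact).image (fun ν => ν⁻¹ + lam)).mono ?_
    intro μ hμ
    obtain ⟨hne, hev⟩ := key μ hμ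
    exact ⟨(μ - lam)⁻¹, ⟨hev, inv_ne_zero hne⟩, by simp⟩
  · intro μ hμ
    obtain ⟨hne, hev⟩ := key μ hμ
    obtain ⟨x, hx⟩ := hev.exists_hasEigenvector
    have hRx : R x = (μ - lam)⁻¹ • x := hx.apply_eq_smul
    obtain ⟨h1, h2⟩ := hR₂ x
    have hx' : x = (μ - lam) • R x := by rw [hRx, smul_inv_smul₀ hne]
    refine ⟨x, ?_, hx.2, ?_⟩
    · rw [hx']
      exact Bdom.smul_mem _ h1
    · have h3 : B x = (μ - lam) • B (R x) := by
        rw [← map_smul, ← hx']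
      rw [h3]
      linear_combination (norm := module) (μ - lam) • h2 - lam • hx'
end
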